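/- In the minimum-counterexample setup, the vertex x has exactly two neighbors of degree at least 3 in G. -/

import Mathlib

open SimpleGraph

namespace AEC

variable {V : Type*}

/-- The set of colors appearing (under partial coloring `c`) on colored edges incident
with the vertex `u` (i.e. `F_u`). -/
def colorsAt (G : SimpleGraph V) (c : Sym2 V → Option ℕ) (u : V) : Set ℕ :=
  {γ | ∃ z, G.Adj u z ∧ c s(u, z) = some γ}

/-- `S_ab`: the set of colors appearing on the colored edges incident with `b`
other than the edge `ab`. -/
def Sset (G : SimpleGraph V) (c : Sym2 V → Option ℕ) (a b : V) : Set ℕ :=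
  {γ | ∃ z, G.Adj b z ∧ z ≠ a ∧ c s(b, z) = some γ}

/-- A partial edge coloring (colors are `ℕ`, `none` = uncolored): it may only color
edges of `G`, and colored edges sharing an endpoint receive distinct colors. -/
def ProperPartialColoring (G : SimpleGraph V) (c : Sym2 V → Option ℕ) : Prop :=
  (∀ e, (c e).isSome → e ∈ G.edgeSet) ∧
  ∀ ⦃u v w : V⦄, G.Adj u v → G.Adj u w → v ≠ w → (c s(u, v)).isSome →
    c s(u, v) ≠ c s(u, w)

/-- A valid (acyclic) partial coloring: proper, and no cycle of `G` is bichromatic,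
i.e. no cycle has all of its edges colored using only two colors. -/
def AcyclicPartialColoring (G : SimpleGraph V) (c : Sym2 V → Option ℕ) : Prop :=
  ProperPartialColoring G c ∧
  ∀ (α β : ℕ) (v : V) (W : G.Walk v v), W.IsCycle →
    ¬ ∀ e ∈ W.edges, c e = some α ∨ c e = some β

/-- An acyclic edge coloring of `G` using (at most) `k` colors: a valid partial coloring
that colors every edge of `G` with a color `< k`. -/
def IsAcyclicEdgeColoring (G : SimpleGraph V) (k : ℕ) (c : Sym2 V → Option ℕ) : Prop :=
  AcyclicPartialColoring G c ∧ ∀ e ∈ G.edgeSet, ∃ a, a < k ∧ c e = some a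

/-- `G` is 2-degenerate: every nonempty (induced) subgraph has a vertex of degree at most 2. -/
def TwoDegenerate [DecidableEq V] (G : SimpleGraph V) [DecidableRel G.Adj] : Prop :=
  ∀ s : Finset V, s.Nonempty → ∃ v ∈ s, (s.filter fun u => G.Adj v u).card ≤ 2

/-- A maximal `(α,β)`-bichromatic path from `a` to `b`: a path all of whose edges are
colored `α` or `β`, which cannot be extended at either end. -/
def IsMaximalBichromaticPath (G : SimpleGraph V) (c : Sym2 V → Option ℕ)
    (α β : ℕ) {a b : V} (W : G.Walk a b) : Prop :=
  W.IsPath ∧ (∀ e ∈ W.edges, c e = some α ∨ c e = some β) ∧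
  (∀ w, G.Adj a w → (c s(a, w) = some α ∨ c s(a, w) = some β) → w ∈ W.support) ∧
  (∀ w, G.Adj b w → (c s(b, w) = some α ∨ c s(b, w) = some β) → w ∈ W.support)

/-- An `(α,β,a,b)`-maximal bichromatic path: a maximal `(α,β)`-bichromatic path from
`a` to `b` whose edge incident on `a` is colored `α`. -/
def IsMaxBichromaticPathFrom (G : SimpleGraph V) (c : Sym2 V → Option ℕ)
    (α β : ℕ) {a b : V} (W : G.Walk a b) : Prop :=
  IsMaximalBichromaticPath G c α β W ∧ ∃ e, W.edges.head? = some e ∧ c e = some α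

/-- An `(α,β,ab)`-critical path: a maximal `(α,β)`-bichromatic path from `a` to `b` whose
edges incident on `a` and on `b` are both colored `α`. -/
def IsCriticalPath (G : SimpleGraph V) (c : Sym2 V → Option ℕ)
    (α β : ℕ) {a b : V} (W : G.Walk a b) : Prop :=
  IsMaxBichromaticPathFrom G c α β W ∧ ∃ e, W.edges.getLast? = some e ∧ c e = some α

/-- `F''_x(c)`: colors of edges from `x` to its neighbors (other than `y`) of degree ≥ 3. -/
def Fpp [Fintype V] (G : SimpleGraph V) [DecidableRel G.Adj]
    (c : Sym2 V → Option ℕ) (x y : V) : Set ℕ :=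
  {γ | ∃ z, G.Adj x z ∧ z ≠ y ∧ 3 ≤ G.degree z ∧ c s(x, z) = some γ}

/-- `F'_x(c)`: colors of edges from `x` to its neighbors (other than `y`) of degree 2. -/
def Fp [Fintype V] (G : SimpleGraph V) [DecidableRel G.Adj]
    (c : Sym2 V → Option ℕ) (x y : V) : Set ℕ :=
  {γ | ∃ z, G.Adj x z ∧ z ≠ y ∧ G.degree z = 2 ∧ c s(x, z) = some γ}

/-- `F_x(c) = F'_x(c) ∪ F''_x(c)`. -/
def Fx [Fintype V] (G : SimpleGraph V) [DecidableRel G.Adj]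
    (c : Sym2 V → Option ℕ) (x y : V) : Set ℕ :=
  Fp G c x y ∪ Fpp G c x y

/-- Recoloring (or coloring) the edge `uv` with a color not seen at its ends keeps an acyclic edge
coloring acyclic, provided no cycle through `uv` becomes bichromatic. -/
theorem IsAcyclicEdgeColoring.update [DecidableEq V] {K H : SimpleGraph V} {k a : ℕ}
    {c : Sym2 V → Option ℕ} {u v : V} (hKH : K ≤ H) (hHK : H.deleteEdges {s(u, v)} ≤ K)
    (hc : IsAcyclicEdgeColoring K k c) (huv : H.Adj u v) (ha : a < k)
    (hu : ∀ w, H.Adj u w → w ≠ v → c s(u, w) ≠ some a)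
    (hv : ∀ w, H.Adj v w → w ≠ u → c s(v, w) ≠ some a)
    (hcyc : ∀ (α β : ℕ) (w : V) (W : H.Walk w w), W.IsCycle → s(u, v) ∈ W.edges →
      ¬ ∀ e ∈ W.edges, Function.update c s(u, v) (some a) e = some α ∨
        Function.update c s(u, v) (some a) e = some β) :
    IsAcyclicEdgeColoring H k (Function.update c s(u, v) (some a)) := by
  have hK : ∀ e ∈ H.edgeSet, e ≠ s(u, v) → e ∈ K.edgeSet := fun e he hne =>
    edgeSet_mono hHK (by simp [edgeSet_deleteEdges, he, hne])
  have hnew : ∀ p q r, H.Adj p q → q ≠ r → s(p, r) = s(u, v) → c s(p, q) ≠ some a := by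
    intro p q r hpq hqr h
    rcases Sym2.eq_iff.1 h with ⟨rfl, rfl⟩ | ⟨rfl, rfl⟩
    · exact hu q hpq hqr
    · exact hv q hpq hqr
  refine ⟨⟨⟨fun e he => ?_, fun p q r hpq hpr hqr hs => ?_⟩, fun α β w W hW hcol => ?_⟩,
    fun e he => ?_⟩
  · by_cases h : e = s(u, v)
    · exact h ▸ huv
    · rw [Function.update_of_ne h] at he
      exact edgeSet_mono hKH (hc.1.1.1 e he)
  · by_cases h₁ : s(p, q) = s(u, v)
    · have h₂ : s(p, r) ≠ s(u, v) := fun h => hqr (Sym2.congr_right.1 (h₁.trans h.symm))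
      rw [h₁, Function.update_self, Function.update_of_ne h₂]
      exact (hnew p r q hpr hqr.symm h₁).symm
    · rw [Function.update_of_ne h₁] at hs ⊢
      by_cases h₂ : s(p, r) = s(u, v)
      · rw [h₂, Function.update_self]
        exact hnew p q r hpq hqr h₂
      · rw [Function.update_of_ne h₂]
        exact hc.1.1.2 (hK _ hpq h₁) (hK _ hpr h₂) hqr hs
  · by_cases h : s(u, v) ∈ W.edges
    · exact hcyc α β w W hW h hcol
    · have hne : ∀ e ∈ W.edges, e ≠ s(u, v) := fun e he h' => h (h' ▸ he)
      have hmem : ∀ e ∈ W.edges, e ∈ K.edgeSet := fun e he =>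
        hK e (W.edges_subset_edgeSet he) (hne e he)
      refine hc.1.2 α β w (W.transfer K hmem) (hW.transfer hmem) fun e he => ?_
      rw [Walk.edges_transfer] at he
      simpa [Function.update_of_ne (hne e he)] using hcol e he
  · by_cases h : e = s(u, v)
    · exact ⟨a, ha, by rw [h, Function.update_self]⟩
    · rw [Function.update_of_ne h]
      exact hc.2 e (hK e he h)

/-- A vertex on a cycle has, along the cycle, a neighbor different from any given vertex. -/
theorem exists_mem_edges_ne_of_isCycle {G : SimpleGraph V} {v : V} {W : G.Walk v v}
    (hW : W.IsCycle) {p : V} (hp : p ∈ W.support) (q : V) : ∃ r, r ≠ q ∧ s(p, r) ∈ W.edges := by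
  have h := hW.ncard_neighborSet_toSubgraph_eq_two hp
  obtain ⟨r, hr, hrq⟩ := Set.exists_ne_of_one_lt_ncard (h ▸ Nat.one_lt_two) q
  exact ⟨r, hrq, W.adj_toSubgraph_iff_mem_edges.1 hr⟩

/-- If `y` has degree two with neighbors `x` and `y'`, and an acyclic edge coloring of `G - xy` does
not extend to `G` by giving `xy` the color `γ`, then there is a path `x z w` with colors
`c(yy')`, `γ`. -/
theorem exists_path_of_not_extendable [DecidableEq V] {G : SimpleGraph V} {k γ β : ℕ}
    {c : Sym2 V → Option ℕ} {x y y' : V} (hmin : ¬ ∃ c, IsAcyclicEdgeColoring G k c)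
    (hc : IsAcyclicEdgeColoring (G.deleteEdges {s(x, y)}) k c) (hxy : G.Adj x y)
    (hy : ∀ w, G.Adj y w → w = x ∨ w = y') (hβ : c s(y, y') = some β)
    (hγ : γ < k) (hγβ : γ ≠ β) (hγx : ∀ w, G.Adj x w → w ≠ y → c s(x, w) ≠ some γ) :
    ∃ z w, G.Adj x z ∧ z ≠ y ∧ c s(x, z) = some β ∧ G.Adj z w ∧ w ≠ x ∧ c s(z, w) = some γ := by
  have hy'x : y' ≠ x := by
    rintro rfl
    have := hc.1.1.1 s(y, y') (by simp [hβ])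
    simp [edgeSet_deleteEdges, Sym2.eq_swap] at this
  by_contra hno
  refine hmin ⟨_, hc.update (deleteEdges_le _) le_rfl hxy hγ hγx (fun w hw hwx => ?_)
    fun α₁ α₂ v W hW hmem hcol => ?_⟩
  · rw [(hy w hw).resolve_left hwx, hβ]
    exact fun h => hγβ (Option.some.inj h).symm
  · have hcol' : ∀ p q, s(p, q) ∈ W.edges → s(p, q) ≠ s(x, y) →
        c s(p, q) = some α₁ ∨ c s(p, q) = some α₂ := fun p q h hne => by
      simpa [Function.update_of_ne hne] using hcol _ h
    have hγα : γ = α₁ ∨ γ = α₂ := by simpa using hcol _ hmem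
    obtain ⟨t, htx, ht⟩ := exists_mem_edges_ne_of_isCycle hW (W.snd_mem_support_of_mem_edges hmem) x
    obtain rfl := (hy t (W.adj_of_mem_edges ht)).resolve_left htx
    have hβα := hcol' _ _ ht (by
      intro h
      rcases Sym2.eq_iff.1 h with ⟨rfl, -⟩ | ⟨-, h⟩
      · exact hxy.ne rfl
      · exact htx h)
    rw [hβ, Option.some_inj, Option.some_inj] at hβα
    have hcol₂ : ∀ p q, s(p, q) ∈ W.edges → s(p, q) ≠ s(x, y) →
        c s(p, q) = some γ ∨ c s(p, q) = some β := fun p q h hne => by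
      have := hcol' p q h hne
      grind
    obtain ⟨z, hzy, hz⟩ :=
      exists_mem_edges_ne_of_isCycle hW (W.fst_mem_support_of_mem_edges hmem) y
    have hxz : G.Adj x z := W.adj_of_mem_edges hz
    have hzne : s(x, z) ≠ s(x, y) := fun h => hzy (Sym2.congr_right.1 h)
    have hxzβ : c s(x, z) = some β := (hcol₂ x z hz hzne).resolve_left (hγx z hxz hzy)
    obtain ⟨w, hwx, hw⟩ :=
      exists_mem_edges_ne_of_isCycle hW (W.snd_mem_support_of_mem_edges hz) x
    have hzw : G.Adj z w := W.adj_of_mem_edges hw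
    have hwne : s(z, w) ≠ s(x, y) := by
      intro h
      rcases Sym2.eq_iff.1 h with ⟨h, -⟩ | ⟨h, -⟩
      · exact hxz.ne h.symm
      · exact hzy h
    refine hno ⟨z, w, hxz, hzy, hxzβ, hzw, hwx, (hcol₂ z w hw hwne).resolve_right fun h => ?_⟩
    have hzx : s(z, x) ≠ s(x, y) := fun h => hzne (Sym2.eq_swap.trans h)
    refine hc.1.1.2 (u := z) (v := w) (w := x) (by simp [deleteEdges_adj, hzw, hwne])
      (by simp only [deleteEdges_adj, Set.mem_singleton_iff]; exact ⟨hxz.symm, hzx⟩)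
      hwx (by simp [h]) ?_
    rw [h, Sym2.eq_swap, hxzβ]

/-- If `y` has degree two with neighbors `x` and `y'`, and no acyclic edge coloring of `G - xy`
extends to `G`, then the color of `yy'` occurs on an edge from `x` to a vertex of degree at least
three. -/
theorem exists_three_le_degree_of_not_extendable [Fintype V] [DecidableEq V] {G : SimpleGraph V}
    [DecidableRel G.Adj] {β : ℕ} {c : Sym2 V → Option ℕ} {x y y' : V}
    (hmin : ¬ ∃ c, IsAcyclicEdgeColoring G (G.maxDegree + 1) c)
    (hc : IsAcyclicEdgeColoring (G.deleteEdges {s(x, y)}) (G.maxDegree + 1) c) (hxy : G.Adj x y)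
    (hy : ∀ w, G.Adj y w → w = x ∨ w = y') (hβ : c s(y, y') = some β) :
    ∃ z, G.Adj x z ∧ 3 ≤ G.degree z ∧ c s(x, z) = some β := by
  set used := ((G.neighborFinset x).erase y).image fun w => (c s(x, w)).getD 0 with hused
  have hcard : 1 < (Finset.range (G.maxDegree + 1) \ used).card := by
    have h₁ : used.card ≤ G.degree x - 1 := by
      refine Finset.card_image_le.trans ?_
      rw [Finset.card_erase_of_mem (by simpa using hxy), card_neighborFinset_eq_degree]
    have h₂ : 0 < G.degree x := (G.degree_pos_iff_exists_adj x).2 ⟨y, hxy⟩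
    have h₃ := G.degree_le_maxDegree x
    have h₄ := Finset.le_card_sdiff used (Finset.range (G.maxDegree + 1))
    rw [Finset.card_range] at h₄
    omega
  have hpath : ∀ γ ∈ Finset.range (G.maxDegree + 1) \ used, γ ≠ β →
      ∃ z w, G.Adj x z ∧ z ≠ y ∧ c s(x, z) = some β ∧ G.Adj z w ∧ w ≠ x ∧ c s(z, w) = some γ := by
    intro γ hγ hγβ
    rw [Finset.mem_sdiff, Finset.mem_range] at hγ
    refine exists_path_of_not_extendable hmin hc hxy hy hβ hγ.1 hγβ fun w hw hwy h => hγ.2 ?_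
    exact Finset.mem_image.2 ⟨w, by simp [hw, hwy], by simp [h]⟩
  obtain ⟨γ, hγ, hγβ⟩ := Finset.exists_mem_ne hcard β
  obtain ⟨z, w, hxz, hzy, hz, hzw, hwx, hw⟩ := hpath γ hγ hγβ
  have hβused : β ∈ used := Finset.mem_image.2 ⟨z, by simp [hxz, hzy], by simp [hz]⟩
  obtain ⟨δ, hδ, hδγ⟩ := Finset.exists_mem_ne hcard γ
  obtain ⟨z', w', hxz', hzy', hz', hzw', hwx', hw'⟩ := hpath δ hδ fun h =>
    (Finset.mem_sdiff.1 hδ).2 (h ▸ hβused)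
  have hzz : z' = z := by
    by_contra hne
    refine hc.1.1.2 (u := x) (v := z') (w := z) ?_ ?_ hne (by simp [hz']) (hz'.trans hz.symm)
    · exact (hc.1.1.1 s(x, z') (by simp [hz']))
    · exact (hc.1.1.1 s(x, z) (by simp [hz]))
  subst hzz
  refine ⟨z', hxz, ?_, hz⟩
  have hww : w ≠ w' := by
    rintro rfl
    exact hδγ (Option.some.inj (hw'.symm.trans hw))
  rw [← card_neighborFinset_eq_degree, ← Finset.card_eq_three.2 ⟨x, w, w', hwx.symm, hwx'.symm,
    hww, rfl⟩]
  exact Finset.card_le_card (by simp [Finset.insert_subset_iff, hxz.symm, hzw, hzw'])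

/-- in the minimum-counterexample setup, the vertex `x` has exactly two
neighbors of degree at least 3 in `G`. -/
theorem two_neighbors_of_degree_ge_three
    {V : Type*} [Fintype V] [DecidableEq V] (G : SimpleGraph V) [DecidableRel G.Adj]
    (h2deg : TwoDegenerate G)
    (hmin : ¬ ∃ c : Sym2 V → Option ℕ, IsAcyclicEdgeColoring G (G.maxDegree + 1) c)
    (hdel : ∀ e ∈ G.edgeSet, ∃ c : Sym2 V → Option ℕ,
      IsAcyclicEdgeColoring (G.deleteEdges {e}) (G.maxDegree + 1) c)
    (x : V)
    (hxdeg2 : ∃ z, G.Adj x z ∧ G.degree z = 2)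
    (hxdeg3 : ((G.neighborFinset x).filter fun z => 3 ≤ G.degree z).card ≤ 2) :
    ((G.neighborFinset x).filter fun z => 3 ≤ G.degree z).card = 2 := by
  refine le_antisymm hxdeg3 ?_
  obtain ⟨y, hxy, hydeg⟩ := hxdeg2
  obtain ⟨y', hyy', hy'x, hy⟩ : ∃ y', G.Adj y y' ∧ y' ≠ x ∧ ∀ w, G.Adj y w → w = x ∨ w = y' := by
    obtain ⟨p, q, hpq, h⟩ := Finset.card_eq_two.1 hydeg
    have hmem : ∀ w, G.Adj y w ↔ w = p ∨ w = q := fun w => by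
      rw [← mem_neighborFinset, h, Finset.mem_insert, Finset.mem_singleton]
    rcases (hmem x).1 hxy.symm with rfl | rfl
    · exact ⟨q, (hmem q).2 (.inr rfl), hpq.symm, fun w hw => (hmem w).1 hw⟩
    · exact ⟨p, (hmem p).2 (.inl rfl), hpq, fun w hw => ((hmem w).1 hw).symm⟩
  obtain ⟨c, hc⟩ := hdel s(x, y) hxy
  have hne : s(y, y') ≠ s(x, y) := by
    intro h
    rcases Sym2.eq_iff.1 h with ⟨h, -⟩ | ⟨-, h⟩
    · exact hxy.ne h.symm
    · exact hy'x h
  have hyy'' : (G.deleteEdges {s(x, y)}).Adj y y' := by simp [deleteEdges_adj, hyy', hne]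
  obtain ⟨β, -, hβ⟩ := hc.2 s(y, y') hyy''
  obtain ⟨z₁, hxz₁, hdeg₁, hz₁⟩ := exists_three_le_degree_of_not_extendable hmin hc hxy hy hβ
  obtain ⟨α, hα, hαy'⟩ : ∃ α < G.maxDegree + 1, ∀ w, G.Adj y' w → c s(y', w) ≠ some α := by
    obtain ⟨α, hα, hα'⟩ := Finset.exists_mem_notMem_of_card_lt_card
      (s := (G.neighborFinset y').image fun w => (c s(y', w)).getD 0)
      (t := Finset.range (G.maxDegree + 1)) (by
        rw [Finset.card_range, Nat.lt_succ_iff]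
        exact Finset.card_image_le.trans (G.degree_le_maxDegree y'))
    exact ⟨α, Finset.mem_range.1 hα, fun w hw h =>
      hα' (Finset.mem_image.2 ⟨w, by simpa using hw, by simp [h]⟩)⟩
  have hy_del : ∀ w, (G.deleteEdges {s(x, y)}).Adj y w → w = y' := fun w hw => by
    rw [deleteEdges_adj] at hw
    refine (hy w hw.1).resolve_left ?_
    rintro rfl
    exact hw.2 Sym2.eq_swap
  have hc' := hc.update (u := y) (v := y') (a := α) le_rfl (deleteEdges_le _) hyy'' hα
    (fun w hw hwy' => (hwy' (hy_del w hw)).elim)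
    (fun w hw _ => hαy' w (deleteEdges_le _ hw))
    (fun _ _ _ W hW hmem _ => by
      obtain ⟨r, hr, h⟩ :=
        exists_mem_edges_ne_of_isCycle hW (W.fst_mem_support_of_mem_edges hmem) y'
      exact hr (hy_del r (W.adj_of_mem_edges h)))
  obtain ⟨z₂, hxz₂, hdeg₂, hz₂⟩ :=
    exists_three_le_degree_of_not_extendable hmin hc' hxy hy (Function.update_self ..)
  have hne₂ : s(x, z₂) ≠ s(y, y') := by
    intro h
    rcases Sym2.eq_iff.1 h with ⟨h, -⟩ | ⟨h, -⟩
    · exact hxy.ne h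
    · exact hy'x h.symm
  rw [Function.update_of_ne hne₂] at hz₂
  have hzz : z₁ ≠ z₂ := by
    rintro rfl
    refine hαy' y hyy'.symm ?_
    rw [Sym2.eq_swap, hβ, ← hz₁, hz₂]
  rw [← Finset.card_pair hzz]
  exact Finset.card_le_card (by simp [Finset.insert_subset_iff, hxz₁, hxz₂, hdeg₁, hdeg₂])

end AEC
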